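/- Theorem 4.6. Suppose k = k(n) = c(n)·n, where c = c(n) satisfies (ln n)² ≤ c and ln c / ln n → 0 as n → ∞ (i.e. c = n^{o(1)}). Then there exists a constant C > 0 such that asymptotically almost surely |ξ(K_n, k) − ln n / ln c| ≤ C·( (ln n/ln c)/√(ln ln ln n) + 1 ); in particular, a.a.s. ξ(K_n,k) ~ ln n / ln c. -/

import Mathlib

open Finset Filter

/-- Positions: `p t a` is the vertex (an element of `Fin n`) occupied by agent `a` at the end of
round `t`. `greenSet n k p t` is the set of green agents at the end of round `t`; the initially
green agent is the agent with index `0`, and a white agent becomes green as soon as it occupies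
the same vertex as a green agent. -/
def greenSet (n k : ℕ) (p : ℕ → Fin k → Fin n) : ℕ → Finset (Fin k)
  | 0 => Finset.univ.filter fun a => ∃ b : Fin k, (b : ℕ) = 0 ∧ p 0 a = p 0 b
  | t + 1 =>
      greenSet n k p t ∪
        Finset.univ.filter fun a => ∃ b ∈ greenSet n k p t, p (t + 1) a = p (t + 1) b

/-- The probability that the `k` agents follow the trajectory prefix `p` during rounds
`0, 1, …, T`: each agent starts at a uniformly random vertex of `K_n` and then moves, each round
and independently of everything else, to a uniformly random vertex distinct from its current
one. -/
noncomputable def prefixProb (n k T : ℕ) (p : Fin (T + 1) → Fin k → Fin n) : ℝ :=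
  ∏ a : Fin k, ((n : ℝ)⁻¹ *
    ∏ t : Fin T, if p t.succ a = p t.castSucc a then 0 else ((n : ℝ) - 1)⁻¹)

/-- `probXiLe n k T` is `P(ξ(K_n, k) ≤ T)`: the probability that the broadcast is complete by
the end of round `T`. -/
noncomputable def probXiLe (n k T : ℕ) : ℝ :=
  ∑ p : Fin (T + 1) → Fin k → Fin n,
    if greenSet n k (fun t a => p ⟨min t T, Nat.lt_succ_of_le (min_le_right t T)⟩ a) T
        = Finset.univ
      then prefixProb n k T p else 0

/-- `probXiEq n k t` is `P(ξ(K_n, k) = t)`. -/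
noncomputable def probXiEq (n k : ℕ) : ℕ → ℝ
  | 0 => probXiLe n k 0
  | t + 1 => probXiLe n k (t + 1) - probXiLe n k t

/-- `probXiMem n k S` is `P(ξ(K_n, k) ∈ S)`: the probability that the broadcasting time of the
process with `k` agents on `K_n` belongs to the set `S ⊆ ℕ`. -/
noncomputable def probXiMem (n k : ℕ) (S : Set ℕ) : ℝ :=
  ∑' t, S.indicator (probXiEq n k) t

/-- `expXi n k = E[ξ(K_n, k)] = ∑_{t ≥ 0} P(ξ(K_n, k) > t)`. -/
noncomputable def expXi (n k : ℕ) : ℝ :=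
  ∑' t, (1 - probXiLe n k t)

section ProductMeasure

variable {n k : ℕ}

open scoped Classical in
/-- The probability of `A` when the agents independently choose vertices, agent `a` with
distribution `q a`. -/
noncomputable def prodProb (q : Fin k → Fin n → ℝ) (A : (Fin k → Fin n) → Prop) : ℝ :=
  ∑ x, if A x then ∏ a, q a (x a) else 0

/-- The number of agents located at `v`. -/
def load (x : Fin k → Fin n) (v : Fin n) : ℕ := #{a | x a = v}

variable {q : Fin k → Fin n → ℝ}

lemma prodProb_nonneg (hq : ∀ a v, 0 ≤ q a v) (A : (Fin k → Fin n) → Prop) :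
    0 ≤ prodProb q A := by
  classical
  exact sum_nonneg fun x _ => by split_ifs; exacts [prod_nonneg fun a _ => hq a _, le_rfl]

lemma sum_prod_eq_one (hq1 : ∀ a, ∑ v, q a v = 1) : ∑ x : Fin k → Fin n, ∏ a, q a (x a) = 1 := by
  rw [← Fintype.piFinset_univ, ← Finset.prod_univ_sum]
  simp [hq1]

lemma prodProb_add_not (hq1 : ∀ a, ∑ v, q a v = 1) (A : (Fin k → Fin n) → Prop) :
    prodProb q A + prodProb q (fun x => ¬ A x) = 1 := by
  classical
  rw [prodProb, prodProb, ← sum_add_distrib, ← sum_prod_eq_one hq1]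
  refine sum_congr rfl fun x _ => ?_
  by_cases h : A x <;> simp [h]

lemma prodProb_mono (hq : ∀ a v, 0 ≤ q a v) {A B : (Fin k → Fin n) → Prop}
    (h : ∀ x, A x → B x) : prodProb q A ≤ prodProb q B := by
  classical
  refine sum_le_sum fun x _ => ?_
  have := prod_nonneg (s := univ) fun a _ => hq a (x a)
  by_cases h1 : A x
  · simp [h1, h x h1]
  · simp only [h1, if_false]; split_ifs <;> simp [this]

lemma prodProb_or_le (hq : ∀ a v, 0 ≤ q a v) (A B : (Fin k → Fin n) → Prop) :
    prodProb q (fun x => A x ∨ B x) ≤ prodProb q A + prodProb q B := by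
  classical
  rw [prodProb, prodProb, prodProb, ← sum_add_distrib]
  refine sum_le_sum fun x _ => ?_
  have := prod_nonneg (s := univ) fun a _ => hq a (x a)
  by_cases h1 : A x <;> by_cases h2 : B x <;> simp [h1, h2, this]

lemma prodProb_exists_le (hq : ∀ a v, 0 ≤ q a v) {ι : Type*} (s : Finset ι)
    (A : ι → (Fin k → Fin n) → Prop) :
    prodProb q (fun x => ∃ i ∈ s, A i x) ≤ ∑ i ∈ s, prodProb q (A i) := by
  classical
  induction s using Finset.induction_on with
  | empty => simp [prodProb]
  | insert i s hi ih =>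
    rw [sum_insert hi]
    refine le_trans ?_ ((prodProb_or_le hq _ _).trans (add_le_add_right ih _))
    exact prodProb_mono hq fun x hx => by simpa using hx

lemma prodProb_le_mul_prod (hq : ∀ a v, 0 ≤ q a v) {A : (Fin k → Fin n) → Prop}
    {C : ℝ} {f : Fin k → Fin n → ℝ} (hC : 0 ≤ C) (hf : ∀ a v, 0 ≤ f a v)
    (h : ∀ x, A x → 1 ≤ C * ∏ a, f a (x a)) :
    prodProb q A ≤ C * ∏ a, ∑ v, q a v * f a v := by
  classical
  rw [Finset.prod_univ_sum, Fintype.piFinset_univ, mul_sum]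
  refine sum_le_sum fun x _ => ?_
  have h0 := prod_nonneg (s := univ) fun a _ => hq a (x a)
  have h1 := prod_nonneg (s := univ) fun a _ => hf a (x a)
  rw [prod_mul_distrib]
  split_ifs with hA
  · nlinarith [h x hA]
  · positivity

lemma prodProb_load_ge_le (hq : ∀ a v, 0 ≤ q a v) (hq1 : ∀ a, ∑ v, q a v = 1) {r : ℝ}
    (hr : ∀ a v, q a v ≤ r) (v : Fin n) (L : ℝ) :
    prodProb q (fun x => L ≤ load x v) ≤ (2:ℝ) ^ (-L) * Real.exp (k * r) := by
  classical
  refine (prodProb_le_mul_prod hq (C := (2:ℝ) ^ (-L))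
    (f := fun _ u => if u = v then 2 else 1) (by positivity)
    (fun a u => by split_ifs <;> norm_num) fun x hx => ?_).trans ?_
  · rw [← prod_filter, prod_const, ← Real.rpow_natCast, ← Real.rpow_add (by norm_num)]
    refine Real.one_le_rpow (by norm_num) ?_
    have : L ≤ (#{a | x a = v} : ℕ) := hx
    linarith
  · gcongr
    rw [Real.exp_nat_mul]
    calc _ ≤ ∏ _a : Fin k, Real.exp r := by
          refine prod_le_prod (fun a _ => sum_nonneg fun u _ => mul_nonneg (hq a u) ?_) fun a _ => ?_
          · split_ifs <;> norm_num
          · have : ∀ u, q a u * (if u = v then 2 else 1) = q a u + if u = v then q a u else 0 := by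
              intro u; split_ifs <;> ring
            simp only [this, sum_add_distrib, hq1, sum_ite_eq', mem_univ, if_true]
            linarith [hr a v, Real.add_one_le_exp r]
      _ = _ := by simp

lemma prodProb_load_le_le (hq : ∀ a v, 0 ≤ q a v) (hq1 : ∀ a, ∑ v, q a v = 1)
    (v : Fin n) (L : ℝ) :
    prodProb q (fun x => (load x v : ℝ) ≤ L) ≤
      (2:ℝ) ^ L * Real.exp (-(∑ a, q a v) / 2) := by
  classical
  refine (prodProb_le_mul_prod hq (C := (2:ℝ) ^ L)
    (f := fun _ u => if u = v then 2⁻¹ else 1) (by positivity)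
    (fun a u => by split_ifs <;> norm_num) fun x hx => ?_).trans ?_
  · rw [← prod_filter, prod_const, inv_pow, ← Real.rpow_natCast, ← Real.rpow_neg (by norm_num),
      ← Real.rpow_add (by norm_num)]
    refine Real.one_le_rpow (by norm_num) ?_
    have : ((#{a | x a = v} : ℕ) : ℝ) ≤ L := hx
    linarith
  · gcongr
    rw [neg_div, sum_div, ← sum_neg_distrib, Real.exp_sum]
    refine prod_le_prod (fun a _ => sum_nonneg fun u _ => mul_nonneg (hq a u) ?_) fun a _ => ?_
    · split_ifs <;> norm_num
    · have : ∀ u, q a u * (if u = v then 2⁻¹ else 1) =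
          q a u - if u = v then q a u / 2 else 0 := by
        intro u; split_ifs <;> ring
      simp only [this, sum_sub_distrib, hq1, sum_ite_eq', mem_univ, if_true]
      linarith [Real.add_one_le_exp (-(q a v / 2))]

lemma prodProb_avoid_le (hq : ∀ a v, 0 ≤ q a v) (hq1 : ∀ a, ∑ v, q a v = 1)
    (v : Fin n) (G : Finset (Fin k)) :
    prodProb q (fun x => ∀ a ∈ G, x a ≠ v) ≤ Real.exp (-∑ a ∈ G, q a v) := by
  classical
  refine (prodProb_le_mul_prod hq (C := 1)
    (f := fun a u => if a ∈ G ∧ u = v then 0 else 1) (by positivity)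
    (fun a u => by split_ifs <;> norm_num) fun x hx => ?_).trans ?_
  · rw [prod_eq_one, one_mul]
    intro a _
    rw [if_neg]
    rintro ⟨h1, h2⟩
    exact hx a h1 h2
  · rw [one_mul, ← sum_neg_distrib, Real.exp_sum, ← Finset.prod_subset (subset_univ G)]
    · refine prod_le_prod (fun a _ => sum_nonneg fun u _ => mul_nonneg (hq a u) ?_) fun a ha => ?_
      · split_ifs <;> norm_num
      · have : ∀ u, q a u * (if a ∈ G ∧ u = v then 0 else 1) =
            q a u - if u = v then q a u else 0 := by
          intro u; simp only [ha, true_and]; split_ifs <;> ring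
        simp only [this, sum_sub_distrib, hq1, sum_ite_eq', mem_univ, if_true]
        linarith [Real.add_one_le_exp (-q a v)]
    · intro a _ ha
      simp [ha, hq1]

lemma prodProb_mapsTo_le (hq : ∀ a v, 0 ≤ q a v) (hq1 : ∀ a, ∑ v, q a v = 1) {r : ℝ}
    (hr : ∀ a v, q a v ≤ r) (S : Finset (Fin n)) (G : Finset (Fin k)) :
    prodProb q (fun x => ∀ a ∈ G, x a ∈ S) ≤ (#S * r) ^ #G := by
  classical
  refine (prodProb_le_mul_prod hq (C := 1)
    (f := fun a u => if a ∈ G ∧ u ∉ S then 0 else 1) (by positivity)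
    (fun a u => by split_ifs <;> norm_num) fun x hx => ?_).trans ?_
  · rw [prod_eq_one, one_mul]
    intro a _
    rw [if_neg]
    rintro ⟨h1, h2⟩
    exact h2 (hx a h1)
  · rw [one_mul, ← Finset.prod_subset (subset_univ G)]
    · rw [← prod_const]
      refine prod_le_prod (fun a _ => sum_nonneg fun u _ => mul_nonneg (hq a u) ?_) fun a ha => ?_
      · split_ifs <;> norm_num
      · have : ∀ u, q a u * (if a ∈ G ∧ u ∉ S then 0 else 1) = if u ∈ S then q a u else 0 := by
          intro u; simp only [ha, true_and]; split_ifs <;> simp_all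
        simp only [this]
        rw [← sum_filter]
        calc _ ≤ ∑ _u ∈ S, r := by
              simp only [filter_mem_eq_inter, univ_inter]
              exact sum_le_sum fun u _ => hr a u
          _ = _ := by simp
    · intro a _ ha
      simp [ha, hq1]

lemma prodProb_card_image_le (hq : ∀ a v, 0 ≤ q a v) (hq1 : ∀ a, ∑ v, q a v = 1) {r : ℝ}
    (hr : ∀ a v, q a v ≤ r) (w : ℕ) (hw : w ≤ n) (G : Finset (Fin k)) :
    prodProb q (fun x => #(G.image x) ≤ w) ≤ n.choose w * (w * r) ^ #G := by
  classical
  calc _ ≤ prodProb q (fun x => ∃ S ∈ powersetCard w (univ : Finset (Fin n)),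
            ∀ a ∈ G, x a ∈ S) := by
        refine prodProb_mono hq fun x hx => ?_
        obtain ⟨S, hS, hc⟩ := exists_superset_card_eq hx (by simpa using hw)
        exact ⟨S, by simpa [mem_powersetCard] using hc,
          fun a ha => hS (mem_image_of_mem _ ha)⟩
    _ ≤ ∑ S ∈ powersetCard w (univ : Finset (Fin n)), (w * r) ^ #G := by
        refine (prodProb_exists_le hq _ _).trans (sum_le_sum fun S hS => ?_)
        rw [← (mem_powersetCard.1 hS).2]
        exact prodProb_mapsTo_le hq hq1 hr S G
    _ = _ := by simp

end ProductMeasure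

lemma choose_mul_pow_le {n m w : ℕ} (hn : 2 ≤ n) (hm : m ≤ n) (hw : 16 * w ≤ m) :
    (n.choose w : ℝ) * (w * ((n:ℝ) - 1)⁻¹) ^ m ≤ Real.exp (-(m / 2 : ℝ)) := by
  have hn0 : (2:ℝ) ≤ n := by exact_mod_cast hn
  obtain ⟨d, rfl⟩ : ∃ d, m = w + d := ⟨m - w, by omega⟩
  have h1 : (n.choose w : ℝ) ≤ (n:ℝ) ^ w / w.factorial := Nat.choose_le_pow_div w n
  have h2 : ((w:ℝ)) ^ w / w.factorial ≤ Real.exp w :=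
    Real.pow_div_factorial_le_exp _ (by positivity) _
  have h3 : ((n:ℝ) - 1)⁻¹ ≤ 2 * (n:ℝ)⁻¹ := by
    rw [← div_eq_mul_inv, inv_eq_one_div, div_le_div_iff₀] <;> linarith
  have h4 : (w:ℝ) * (n:ℝ)⁻¹ ≤ 16⁻¹ := by
    have : (16 * w : ℝ) ≤ n := by exact_mod_cast hw.trans hm
    rw [← div_eq_mul_inv, div_le_iff₀] <;> linarith
  have h5 : (0:ℝ) ≤ ((n:ℝ) - 1)⁻¹ := inv_nonneg.2 (by linarith)
  have e1 : Real.exp 1 ≤ 3 := by linarith [Real.exp_one_lt_d9]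
  have e2 : (2:ℝ)⁻¹ ≤ Real.exp (-(1/2)) := by linarith [Real.add_one_le_exp (-(1/2) : ℝ)]
  calc _ ≤ ((n:ℝ) ^ w / w.factorial) * (w * (2 * (n:ℝ)⁻¹)) ^ (w + d) := by gcongr
    _ = 2 ^ w * ((w:ℝ) ^ w / w.factorial) * (2 * (w * (n:ℝ)⁻¹)) ^ d := by
        have : (n:ℝ) ≠ 0 := by positivity
        rw [pow_add, mul_pow, mul_pow (2:ℝ), inv_pow]
        field_simp
    _ ≤ 2 ^ w * Real.exp w * (2 * 16⁻¹) ^ d := by gcongr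
    _ ≤ 2 ^ w * 3 ^ w * (2⁻¹ ^ 3) ^ d := by
        rw [← Real.exp_one_pow]
        gcongr
        norm_num
    _ ≤ 2 ^ w * 4 ^ w * (2⁻¹ ^ 3) ^ d := by gcongr; norm_num
    _ = (2:ℝ)⁻¹ ^ (w + d) * (2⁻¹ ^ (2 * d - 4 * w)) := by
        have h : (2:ℝ)⁻¹ ^ (2 * d - 4 * w) * 2⁻¹ ^ (4 * w) = 2⁻¹ ^ (2 * d) := by
          rw [← pow_add]; congr 1; omega
        have h' : (2:ℝ)⁻¹ ^ (2 * d - 4 * w) = 2⁻¹ ^ (2 * d) * 2 ^ (4 * w) := by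
          rw [← h, mul_assoc, ← mul_pow]; norm_num
        rw [h', ← mul_pow, ← pow_mul, pow_add, pow_mul' _ 2 d, pow_mul _ 4 w, pow_mul _ 3 d]
        rw [show (2:ℝ)⁻¹ ^ w * 2⁻¹ ^ d * ((2⁻¹ ^ d) ^ 2 * (2 ^ 4) ^ w)
          = (2⁻¹ ^ w * (2 ^ 4) ^ w) * (2⁻¹ ^ d) ^ 3 by ring, ← mul_pow, ← pow_mul, ← pow_mul,
          mul_comm d 3]
        norm_num
    _ ≤ (2:ℝ)⁻¹ ^ (w + d) * 1 := by
        gcongr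
        exact pow_le_one₀ (by norm_num) (by norm_num)
    _ ≤ Real.exp (-(1/2)) ^ (w + d) := by rw [mul_one]; gcongr
    _ = _ := by
        rw [← Real.exp_nat_mul]; push_cast; ring_nf

section Round

variable {n k : ℕ}

/-- Every vertex hosts between `c / 8` and `4 * c` agents. -/
def LoadGood (c : ℝ) (x : Fin k → Fin n) : Prop :=
  ∀ v, c / 8 ≤ load x v ∧ (load x v : ℝ) ≤ 4 * c

/-- The placement `x` is balanced, the agents in `G` are spread over many vertices, and over all
vertices if `G` is a positive fraction of all agents. -/
def RoundGood (c : ℝ) (G : Finset (Fin k)) (x : Fin k → Fin n) : Prop :=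
  LoadGood c x ∧ min #G n < 16 * #(G.image x) ∧
    ((k : ℝ) / 128 ≤ #G → ∀ v, ∃ a ∈ G, x a = v)

variable {q : Fin k → Fin n → ℝ} {c : ℝ}

lemma le_sum_prob (hq : ∀ a v, 0 ≤ q a v) {v : Fin n} {L : ℝ}
    (hL : (#{a | q a v < (n:ℝ)⁻¹} : ℝ) ≤ L) (G : Finset (Fin k)) :
    (#G - L) / n ≤ ∑ a ∈ G, q a v := by
  have h1 : ∀ a ∈ G, (n:ℝ)⁻¹ - (if q a v < (n:ℝ)⁻¹ then (n:ℝ)⁻¹ else 0) ≤ q a v := by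
    intro a _
    split_ifs with h
    · simpa using hq a v
    · linarith
  have h2 : ∑ a ∈ G, (if q a v < (n:ℝ)⁻¹ then (n:ℝ)⁻¹ else 0) ≤ L * (n:ℝ)⁻¹ := by
    rw [← sum_filter, sum_const, nsmul_eq_mul]
    gcongr
    refine le_trans ?_ hL
    exact_mod_cast card_le_card (filter_subset_filter _ (subset_univ G))
  have h3 := sum_le_sum h1
  rw [sum_sub_distrib, sum_const, nsmul_eq_mul] at h3
  rw [div_eq_mul_inv, sub_mul]
  linarith

lemma prodProb_not_loadGood_le (hq : ∀ a v, 0 ≤ q a v) (hq1 : ∀ a, ∑ v, q a v = 1)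
    (hr : ∀ a v, q a v ≤ ((n:ℝ) - 1)⁻¹) (hL : ∀ v, (#{a | q a v < (n:ℝ)⁻¹} : ℝ) ≤ 4 * c)
    (hk : (k:ℝ) = c * n) (hn : 1024 ≤ n) (hc : 0 < c) :
    prodProb q (fun x => ¬ LoadGood c x) ≤ 2 * n * Real.exp (-(c / 256)) := by
  have hn' : (1024:ℝ) ≤ n := by exact_mod_cast hn
  have l1 := Real.log_two_gt_d9
  have l2 := Real.log_two_lt_d9
  have hlow : ∀ v, prodProb q (fun x => (load x v : ℝ) ≤ c / 8) ≤ Real.exp (-(c / 256)) := by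
    intro v
    refine (prodProb_load_le_le hq hq1 v _).trans ?_
    rw [Real.rpow_def_of_pos (by norm_num), ← Real.exp_add, Real.exp_le_exp]
    have h := le_sum_prob hq (hL v) univ
    have h' : c / 2 ≤ (#(univ : Finset (Fin k)) - 4 * c) / n := by
      rw [le_div_iff₀ (by linarith), card_univ, Fintype.card_fin, hk]
      nlinarith
    nlinarith
  have hup : ∀ v, prodProb q (fun x => 4 * c ≤ (load x v : ℝ)) ≤ Real.exp (-(c / 256)) := by
    intro v
    refine (prodProb_load_ge_le hq hq1 hr v _).trans ?_
    rw [Real.rpow_def_of_pos (by norm_num), ← Real.exp_add, Real.exp_le_exp]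
    have h' : (k:ℝ) * ((n:ℝ) - 1)⁻¹ ≤ 2 * c := by
      rw [← div_eq_mul_inv, div_le_iff₀ (by linarith), hk]
      nlinarith
    nlinarith
  calc _ ≤ prodProb q (fun x => (∃ v ∈ (univ : Finset (Fin n)), (load x v : ℝ) ≤ c / 8) ∨
            ∃ v ∈ (univ : Finset (Fin n)), 4 * c ≤ (load x v : ℝ)) := by
        refine prodProb_mono hq fun x hx => ?_
        simp only [LoadGood, not_forall, not_and_or, not_le] at hx
        obtain ⟨v, h | h⟩ := hx
        · exact Or.inl ⟨v, mem_univ _, h.le⟩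
        · exact Or.inr ⟨v, mem_univ _, h.le⟩
    _ ≤ ∑ _v : Fin n, Real.exp (-(c / 256)) + ∑ _v : Fin n, Real.exp (-(c / 256)) := by
        refine (prodProb_or_le hq _ _).trans (add_le_add ?_ ?_)
        · exact (prodProb_exists_le hq _ _).trans (sum_le_sum fun v _ => hlow v)
        · exact (prodProb_exists_le hq _ _).trans (sum_le_sum fun v _ => hup v)
    _ = _ := by simp; ring

lemma prodProb_card_image_small_le (hq : ∀ a v, 0 ≤ q a v) (hq1 : ∀ a, ∑ v, q a v = 1)
    (hr : ∀ a v, q a v ≤ ((n:ℝ) - 1)⁻¹) (hn : 1024 ≤ n) (hc : 0 < c) (hcn : c ≤ 8 * n)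
    {G : Finset (Fin k)} (hG : c / 8 ≤ #G) :
    prodProb q (fun x => 16 * #(G.image x) ≤ min #G n) ≤ Real.exp (-(c / 256)) := by
  obtain ⟨G', hG', hm⟩ := exists_subset_card_eq (min_le_left #G n)
  set m := min #G n with hmdef
  have hmn : m ≤ n := min_le_right _ _
  have hcm : c / 8 ≤ m := by
    rw [hmdef, Nat.cast_min]
    exact le_min hG (by linarith)
  calc _ ≤ prodProb q (fun x => #(G'.image x) ≤ m / 16) := by
        refine prodProb_mono hq fun x hx => ?_
        have : #(G'.image x) ≤ #(G.image x) := card_le_card (image_subset_image hG')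
        omega
    _ ≤ _ := prodProb_card_image_le hq hq1 hr (m / 16) (by omega) G'
    _ ≤ Real.exp (-(m / 2 : ℝ)) := by
        rw [hm]
        exact choose_mul_pow_le (by omega) hmn (by omega)
    _ ≤ _ := by
        rw [Real.exp_le_exp]
        linarith

lemma prodProb_not_surj_le (hq : ∀ a v, 0 ≤ q a v) (hq1 : ∀ a, ∑ v, q a v = 1)
    (hL : ∀ v, (#{a | q a v < (n:ℝ)⁻¹} : ℝ) ≤ 4 * c)
    (hk : (k:ℝ) = c * n) (hn : 1024 ≤ n) (hc : 0 < c)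
    {G : Finset (Fin k)} (hG : (k:ℝ) / 128 ≤ #G) :
    prodProb q (fun x => ¬ ∀ v, ∃ a ∈ G, x a = v) ≤ n * Real.exp (-(c / 256)) := by
  have hn' : (1024:ℝ) ≤ n := by exact_mod_cast hn
  calc _ ≤ prodProb q (fun x => ∃ v ∈ (univ : Finset (Fin n)), ∀ a ∈ G, x a ≠ v) := by
        refine prodProb_mono hq fun x hx => ?_
        push Not at hx
        simpa using hx
    _ ≤ ∑ _v : Fin n, Real.exp (-(c / 256)) := by
        refine (prodProb_exists_le hq _ _).trans (sum_le_sum fun v _ => ?_)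
        refine (prodProb_avoid_le hq hq1 v G).trans ?_
        rw [Real.exp_le_exp, neg_le_neg_iff]
        refine le_trans ?_ (le_sum_prob hq (hL v) G)
        rw [le_div_iff₀ (by linarith)]
        rw [hk] at hG
        nlinarith
    _ = _ := by simp

lemma prodProb_not_roundGood_le (hq : ∀ a v, 0 ≤ q a v) (hq1 : ∀ a, ∑ v, q a v = 1)
    (hr : ∀ a v, q a v ≤ ((n:ℝ) - 1)⁻¹) (hL : ∀ v, (#{a | q a v < (n:ℝ)⁻¹} : ℝ) ≤ 4 * c)
    (hk : (k:ℝ) = c * n) (hn : 1024 ≤ n) (hc : 0 < c) (hcn : c ≤ 8 * n)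
    {G : Finset (Fin k)} (hG : c / 8 ≤ #G) :
    prodProb q (fun x => ¬ RoundGood c G x) ≤ 4 * n * Real.exp (-(c / 256)) := by
  have hn' : (1024:ℝ) ≤ n := by exact_mod_cast hn
  have e0 := Real.exp_pos (-(c / 256))
  have h1 := prodProb_not_loadGood_le hq hq1 hr hL hk hn hc
  have h2 := prodProb_card_image_small_le hq hq1 hr hn hc hcn hG
  have h3 : prodProb q (fun x => ¬ ((k : ℝ) / 128 ≤ #G → ∀ v, ∃ a ∈ G, x a = v)) ≤
      n * Real.exp (-(c / 256)) := by
    by_cases h : (k : ℝ) / 128 ≤ #G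
    · simpa only [h, true_imp_iff] using prodProb_not_surj_le hq hq1 hL hk hn hc h
    · simp only [h, false_imp_iff, not_true, prodProb, if_false, sum_const_zero]
      positivity
  have h4 := prodProb_or_le hq (fun x => 16 * #(G.image x) ≤ min #G n)
    (fun x => ¬ ((k : ℝ) / 128 ≤ #G → ∀ v, ∃ a ∈ G, x a = v))
  have h5 := prodProb_or_le hq (fun x => ¬ LoadGood c x)
    (fun x => 16 * #(G.image x) ≤ min #G n ∨
      ¬ ((k : ℝ) / 128 ≤ #G → ∀ v, ∃ a ∈ G, x a = v))
  have h6 : prodProb q (fun x => ¬ RoundGood c G x) ≤ _ := prodProb_mono hq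
    (B := fun x => ¬ LoadGood c x ∨ 16 * #(G.image x) ≤ min #G n ∨
      ¬ ((k : ℝ) / 128 ≤ #G → ∀ v, ∃ a ∈ G, x a = v)) (by
      intro x hx
      rw [RoundGood, not_and_or, not_and_or, not_lt] at hx
      exact hx)
  nlinarith

end Round

section Trajectory

variable {n k : ℕ}

/-- The distribution of an agent after one round, started from `y`. -/
noncomputable def moveProb (y : Fin k → Fin n) (a : Fin k) (v : Fin n) : ℝ :=
  if v = y a then 0 else ((n : ℝ) - 1)⁻¹

lemma moveProb_nonneg (hn : 2 ≤ n) (y : Fin k → Fin n) (a : Fin k) (v : Fin n) :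
    0 ≤ moveProb y a v := by
  have : (2:ℝ) ≤ n := by exact_mod_cast hn
  unfold moveProb
  split_ifs
  · exact le_rfl
  · exact inv_nonneg.2 (by linarith)

lemma moveProb_le (hn : 2 ≤ n) (y : Fin k → Fin n) (a : Fin k) (v : Fin n) :
    moveProb y a v ≤ ((n : ℝ) - 1)⁻¹ := by
  have : (2:ℝ) ≤ n := by exact_mod_cast hn
  unfold moveProb
  split_ifs
  · exact inv_nonneg.2 (by linarith)
  · exact le_rfl

lemma sum_moveProb (hn : 2 ≤ n) (y : Fin k → Fin n) (a : Fin k) :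
    ∑ v, moveProb y a v = 1 := by
  have h : (2:ℝ) ≤ n := by exact_mod_cast hn
  have : ∀ v, moveProb y a v = ((n : ℝ) - 1)⁻¹ - if v = y a then ((n : ℝ) - 1)⁻¹ else 0 := by
    intro v; unfold moveProb; split_ifs <;> ring
  simp only [this, sum_sub_distrib, sum_ite_eq', mem_univ, if_true, sum_const, card_univ,
    Fintype.card_fin, nsmul_eq_mul]
  have : (n:ℝ) - 1 ≠ 0 := by linarith
  field_simp

lemma card_moveProb_lt_le (hn : 2 ≤ n) (y : Fin k → Fin n) (v : Fin n) :
    #{a | moveProb y a v < (n:ℝ)⁻¹} ≤ load y v := by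
  have h : (2:ℝ) ≤ n := by exact_mod_cast hn
  refine card_le_card fun a => ?_
  simp only [mem_filter, mem_univ, true_and]
  intro ha
  by_contra hne
  rw [moveProb, if_neg (fun h => hne h.symm)] at ha
  exact absurd ha (not_lt.2 (inv_anti₀ (by linarith) (by linarith)))

/-- Extension of a trajectory prefix to all times, constant after the last round. -/
def extend {T : ℕ} (p : Fin (T + 1) → Fin k → Fin n) : ℕ → Fin k → Fin n :=
  fun t a => p ⟨min t T, Nat.lt_succ_of_le (min_le_right t T)⟩ a

lemma extend_snoc_of_le {T t : ℕ} (p : Fin (T + 1) → Fin k → Fin n) (x : Fin k → Fin n)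
    (ht : t ≤ T) :
    extend (Fin.snoc (α := fun _ => Fin k → Fin n) p x) t = extend p t := by
  funext a
  have h : (⟨min t (T + 1), Nat.lt_succ_of_le (min_le_right t (T + 1))⟩ : Fin (T + 2)) =
      Fin.castSucc ⟨min t T, Nat.lt_succ_of_le (min_le_right t T)⟩ := by
    ext; simp [ht, Nat.le_succ_of_le ht]
  simp only [extend]
  rw [h, Fin.snoc_castSucc]

lemma extend_snoc_last {T : ℕ} (p : Fin (T + 1) → Fin k → Fin n) (x : Fin k → Fin n) :
    extend (Fin.snoc (α := fun _ => Fin k → Fin n) p x) (T + 1) = x := by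
  funext a
  have h : (⟨min (T + 1) (T + 1), Nat.lt_succ_of_le (min_le_right (T + 1) (T + 1))⟩ :
      Fin (T + 2)) = Fin.last (T + 1) := by
    ext; simp
  simp only [extend]
  rw [h, Fin.snoc_last]

lemma extend_last {T : ℕ} (p : Fin (T + 1) → Fin k → Fin n) :
    extend p T = p (Fin.last T) := by
  funext a
  simp only [extend]
  congr 2
  simp

lemma prefixProb_snoc {T : ℕ} (p : Fin (T + 1) → Fin k → Fin n) (x : Fin k → Fin n) :
    prefixProb n k (T + 1) (Fin.snoc (α := fun _ => Fin k → Fin n) p x) =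
      prefixProb n k T p * ∏ a, moveProb (extend p T) a (x a) := by
  rw [prefixProb, prefixProb, ← prod_mul_distrib, extend_last]
  refine prod_congr rfl fun a _ => ?_
  rw [Fin.prod_univ_castSucc, mul_assoc]
  simp only [Fin.succ_last, Fin.snoc_last, Fin.snoc_castSucc, Fin.succ_castSucc]
  rfl

lemma prefixProb_nonneg (hn : 2 ≤ n) {T : ℕ} (p : Fin (T + 1) → Fin k → Fin n) :
    0 ≤ prefixProb n k T p := by
  have : (2:ℝ) ≤ n := by exact_mod_cast hn
  have h : 0 ≤ ((n:ℝ) - 1)⁻¹ := inv_nonneg.2 (by linarith)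
  refine prod_nonneg fun a _ => mul_nonneg (by positivity) (prod_nonneg fun t _ => ?_)
  split_ifs
  exacts [le_rfl, h]

open scoped Classical in
/-- The probability that the first `T + 1` positions of all agents satisfy `A`. -/
noncomputable def trajProb (n k T : ℕ) (A : (ℕ → Fin k → Fin n) → Prop) : ℝ :=
  ∑ p : Fin (T + 1) → Fin k → Fin n, if A (extend p) then prefixProb n k T p else 0

lemma trajProb_succ (T : ℕ) (A : (ℕ → Fin k → Fin n) → Prop) :
    trajProb n k (T + 1) A = ∑ p : Fin (T + 1) → Fin k → Fin n, prefixProb n k T p *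
      prodProb (moveProb (extend p T))
        (fun x => A (extend (Fin.snoc (α := fun _ => Fin k → Fin n) p x))) := by
  classical
  rw [trajProb, ← (Fin.snocEquiv fun _ : Fin (T + 2) => (Fin k → Fin n)).sum_comp,
    Fintype.sum_prod_type_right]
  refine sum_congr rfl fun p _ => ?_
  rw [prodProb, mul_sum]
  refine sum_congr rfl fun x _ => ?_
  rw [mul_ite, mul_zero, ← prefixProb_snoc]
  rfl

lemma trajProb_mono (hn : 2 ≤ n) {T : ℕ} {A B : (ℕ → Fin k → Fin n) → Prop}
    (h : ∀ p, A p → B p) : trajProb n k T A ≤ trajProb n k T B := by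
  classical
  refine sum_le_sum fun p _ => ?_
  have := prefixProb_nonneg hn p
  by_cases h1 : A (extend p)
  · simp [h1, h _ h1]
  · simp only [h1, if_false]; split_ifs <;> simp [this]

lemma trajProb_add_not (T : ℕ) (A : (ℕ → Fin k → Fin n) → Prop) :
    trajProb n k T A + trajProb n k T (fun p => ¬ A p) = trajProb n k T fun _ => True := by
  classical
  rw [trajProb, trajProb, trajProb, ← sum_add_distrib]
  refine sum_congr rfl fun p _ => ?_
  by_cases h : A (extend p) <;> simp [h]

/-- `A` only depends on the positions at times at most `T`. -/
def DependsUpTo (T : ℕ) (A : (ℕ → Fin k → Fin n) → Prop) : Prop :=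
  ∀ p p' : ℕ → Fin k → Fin n, (∀ t ≤ T, p t = p' t) → A p → A p'

lemma DependsUpTo.snoc_iff {T : ℕ} {A : (ℕ → Fin k → Fin n) → Prop} (hA : DependsUpTo T A)
    (p : Fin (T + 1) → Fin k → Fin n) (x : Fin k → Fin n) :
    A (extend (Fin.snoc (α := fun _ => Fin k → Fin n) p x)) ↔ A (extend p) :=
  ⟨hA _ _ fun _ ht => extend_snoc_of_le p x ht, hA _ _ fun _ ht => (extend_snoc_of_le p x ht).symm⟩

lemma trajProb_succ_of_dependsUpTo (hn : 2 ≤ n) {T : ℕ} {A : (ℕ → Fin k → Fin n) → Prop}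
    (hA : DependsUpTo T A) : trajProb n k (T + 1) A = trajProb n k T A := by
  classical
  rw [trajProb_succ, trajProb]
  refine sum_congr rfl fun p _ => ?_
  simp only [hA.snoc_iff, prodProb]
  split_ifs
  · rw [sum_prod_eq_one (sum_moveProb hn _), mul_one]
  · simp

lemma trajProb_zero (A : (ℕ → Fin k → Fin n) → Prop) :
    trajProb n k 0 A = prodProb (fun _ _ => (n:ℝ)⁻¹) (fun x => A (fun _ => x)) := by
  classical
  rw [trajProb, prodProb, ← (Equiv.funUnique (Fin 1) (Fin k → Fin n)).symm.sum_comp]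
  refine sum_congr rfl fun x _ => ?_
  have h : extend (T := 0) ((Equiv.funUnique (Fin 1) (Fin k → Fin n)).symm x) = fun _ => x := by
    funext t a; rfl
  rw [h]
  simp [prefixProb]

lemma trajProb_true (hn : 2 ≤ n) (T : ℕ) : trajProb n k T (fun _ => True) = 1 := by
  induction T with
  | zero =>
    rw [trajProb_zero]
    simp only [prodProb, if_true]
    refine sum_prod_eq_one (q := fun _ _ => (n:ℝ)⁻¹) fun a => ?_
    have : (n:ℝ) ≠ 0 := by positivity
    simp [this]
  | succ T ih => rw [trajProb_succ_of_dependsUpTo hn (fun _ _ _ h => h), ih]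

lemma trajProb_le_succ_add (hn : 2 ≤ n) {T : ℕ} {A B : (ℕ → Fin k → Fin n) → Prop}
    {R : (ℕ → Fin k → Fin n) → (Fin k → Fin n) → Prop} {ε : ℝ} (hε : 0 ≤ ε)
    (hA : DependsUpTo T A) (hR : ∀ x, DependsUpTo T fun p => R p x)
    (hB : ∀ p, A p → R p (p (T + 1)) → B p)
    (h : ∀ p, A p → prodProb (moveProb (p T)) (fun x => ¬ R p x) ≤ ε) :
    trajProb n k T A ≤ trajProb n k (T + 1) B + ε := by
  classical
  have hle : trajProb n k T A ≤ ∑ p : Fin (T + 1) → Fin k → Fin n,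
      (prefixProb n k T p * prodProb (moveProb (extend p T))
        (fun x => B (extend (Fin.snoc (α := fun _ => Fin k → Fin n) p x)))
      + prefixProb n k T p * ε) := by
    refine sum_le_sum fun p _ => ?_
    rw [← mul_add]
    have hp := prefixProb_nonneg hn p
    have hm := moveProb_nonneg hn (extend p T)
    split_ifs with hAp
    · refine le_mul_of_one_le_right hp ?_
      rw [← prodProb_add_not (sum_moveProb hn (extend p T)) (R (extend p))]
      refine add_le_add (prodProb_mono hm fun x hx => ?_) (h _ hAp)
      refine hB _ ((hA.snoc_iff p x).2 hAp) ?_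
      rw [extend_snoc_last]
      exact ((hR x).snoc_iff p x).2 hx
    · exact mul_nonneg hp (add_nonneg (prodProb_nonneg hm _) hε)
  rw [sum_add_distrib, ← sum_mul, ← trajProb_succ] at hle
  have := trajProb_true (k := k) hn T
  simp only [trajProb, if_true] at this
  rwa [this, one_mul] at hle

lemma greenSet_congr {p p' : ℕ → Fin k → Fin n} {T : ℕ} (h : ∀ t ≤ T, p t = p' t) :
    greenSet n k p T = greenSet n k p' T := by
  induction T with
  | zero => simp only [greenSet, h 0 le_rfl]
  | succ T ih => simp only [greenSet, h (T + 1) le_rfl, ih fun t ht => h t (by omega)]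

lemma probXiLe_eq_trajProb (T : ℕ) :
    probXiLe n k T = trajProb n k T fun p => greenSet n k p T = univ := by
  classical
  rw [probXiLe, trajProb]
  refine sum_congr rfl fun p _ => ?_
  by_cases h : greenSet n k (extend p) T = univ
  · rw [if_pos h]
    exact if_pos h
  · rw [if_neg h]
    exact if_neg h

lemma probXiLe_le_succ (hn : 2 ≤ n) (T : ℕ) : probXiLe n k T ≤ probXiLe n k (T + 1) := by
  rw [probXiLe_eq_trajProb, probXiLe_eq_trajProb, ← trajProb_succ_of_dependsUpTo hn]
  · refine trajProb_mono hn fun p hp => ?_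
    rw [greenSet, hp, union_eq_left.2 (subset_univ _)]
  · intro p p' h hp
    rw [← hp, greenSet_congr h]

lemma probXiLe_le_one (hn : 2 ≤ n) (T : ℕ) : probXiLe n k T ≤ 1 := by
  rw [probXiLe_eq_trajProb, ← trajProb_true (k := k) hn T]
  exact trajProb_mono hn fun _ _ => trivial

lemma probXiLe_nonneg (hn : 2 ≤ n) (T : ℕ) : 0 ≤ probXiLe n k T := by
  rw [probXiLe_eq_trajProb]
  classical
  exact sum_nonneg fun p _ => by split_ifs; exacts [prefixProb_nonneg hn p, le_rfl]

lemma probXiEq_nonneg (hn : 2 ≤ n) (t : ℕ) : 0 ≤ probXiEq n k t := by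
  cases t with
  | zero => exact probXiLe_nonneg hn 0
  | succ t => exact sub_nonneg.2 (probXiLe_le_succ hn t)

lemma sum_range_probXiEq (T : ℕ) :
    ∑ t ∈ range (T + 1), probXiEq n k t = probXiLe n k T := by
  induction T with
  | zero => simp [probXiEq]
  | succ T ih => rw [sum_range_succ, ih, probXiEq]; ring

lemma probXiMem_bounds (hn : 2 ≤ n) {S : Set ℕ} {A B N : ℕ} {δ : ℝ} (hδ : 0 ≤ δ)
    (hN : ∀ t ∈ S, t ≤ N) (hS : ∀ t, A ≤ t → t ≤ B → t ∈ S)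
    (hA : ∀ t < A, probXiLe n k t ≤ δ) (hB : 1 - δ ≤ probXiLe n k B) :
    1 - 2 * δ ≤ probXiMem n k S ∧ probXiMem n k S ≤ 1 := by
  have hsum : probXiMem n k S = ∑ t ∈ range (N + 1), S.indicator (probXiEq n k) t := by
    refine tsum_eq_sum fun t ht => Set.indicator_of_notMem (fun h => ht ?_) _
    exact mem_range_succ_iff.2 (hN t h)
  have hi0 : ∀ t, 0 ≤ S.indicator (probXiEq n k) t :=
    fun t => Set.indicator_nonneg (fun t _ => probXiEq_nonneg hn t) t
  have hfilter : ∑ t ∈ range A, probXiEq n k t ≤ δ := by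
    cases A with
    | zero => simpa using hδ
    | succ A => rw [sum_range_probXiEq]; exact hA A (Nat.lt_succ_self A)
  constructor
  · have h1 : ∑ t ∈ range (B + 1), probXiEq n k t ≤
        ∑ t ∈ range A, probXiEq n k t + ∑ t ∈ Finset.Ico A (B + 1), probXiEq n k t := by
      rw [← sum_union]
      · refine sum_le_sum_of_subset_of_nonneg (fun t ht => ?_) fun t _ _ => probXiEq_nonneg hn t
        simp only [mem_union, mem_range, mem_Ico] at ht ⊢
        omega
      · rw [disjoint_left]
        intro t ht
        simp only [mem_range, mem_Ico] at ht ⊢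
        omega
    have h2 : ∑ t ∈ Finset.Ico A (B + 1), probXiEq n k t ≤
        ∑ t ∈ range (N + 1), S.indicator (probXiEq n k) t := by
      have : ∀ t ∈ Finset.Ico A (B + 1), t ∈ S := fun t ht => by
        rw [mem_Ico] at ht
        exact hS t ht.1 (by omega)
      calc _ = ∑ t ∈ Finset.Ico A (B + 1), S.indicator (probXiEq n k) t :=
            sum_congr rfl fun t ht => (Set.indicator_of_mem (this t ht) _).symm
        _ ≤ _ := sum_le_sum_of_subset_of_nonneg
            (fun t ht => mem_range_succ_iff.2 (hN t (this t ht))) fun t _ _ => hi0 t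
    rw [sum_range_probXiEq] at h1
    rw [hsum]
    linarith
  · rw [hsum]
    refine le_trans (sum_le_sum fun t _ => ?_)
      ((sum_range_probXiEq (n := n) (k := k) N).trans_le (probXiLe_le_one hn N))
    exact Set.indicator_le_self' (fun t _ => probXiEq_nonneg hn t) t

end Trajectory

section GoodTrajectory

variable {n k : ℕ} {c : ℝ}

/-- The trajectory is balanced at time `0` and the rounds `1, …, T` are good for the green
agents. -/
def GoodTraj (c : ℝ) (T : ℕ) (p : ℕ → Fin k → Fin n) : Prop :=
  LoadGood c (p 0) ∧ ∀ t < T, RoundGood c (greenSet n k p t) (p (t + 1))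

lemma GoodTraj.loadGood {T : ℕ} {p : ℕ → Fin k → Fin n} (h : GoodTraj c T p) {t : ℕ}
    (ht : t ≤ T) : LoadGood c (p t) := by
  cases t with
  | zero => exact h.1
  | succ t => exact (h.2 t ht).1

lemma GoodTraj.mono {T t : ℕ} {p : ℕ → Fin k → Fin n} (h : GoodTraj c T p) (ht : t ≤ T) :
    GoodTraj c t p :=
  ⟨h.1, fun s hs => h.2 s (hs.trans_le ht)⟩

lemma goodTraj_dependsUpTo (T : ℕ) :
    DependsUpTo T (GoodTraj c T : (ℕ → Fin k → Fin n) → Prop) := by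
  intro p p' h hp
  refine ⟨h 0 (Nat.zero_le _) ▸ hp.1, fun t ht => ?_⟩
  rw [← h (t + 1) ht, ← greenSet_congr fun s hs => h s (by omega)]
  exact hp.2 t ht

lemma card_greenSet_zero (hk : 0 < k) (p : ℕ → Fin k → Fin n) :
    #(greenSet n k p 0) = load (p 0) (p 0 ⟨0, hk⟩) := by
  unfold load greenSet
  congr 1
  ext a
  simp only [mem_filter, mem_univ, true_and]
  constructor
  · rintro ⟨b, hb, h⟩
    rwa [show b = ⟨0, hk⟩ from Fin.ext hb] at h
  · exact fun h => ⟨_, rfl, h⟩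

lemma mem_greenSet_succ {p : ℕ → Fin k → Fin n} {t : ℕ} {a : Fin k} :
    a ∈ greenSet n k p (t + 1) ↔ p (t + 1) a ∈ (greenSet n k p t).image (p (t + 1)) := by
  simp only [greenSet, mem_union, mem_filter, mem_univ, true_and, mem_image]
  constructor
  · rintro (h | ⟨b, hb, h⟩)
    · exact ⟨a, h, rfl⟩
    · exact ⟨b, hb, h.symm⟩
  · rintro ⟨b, hb, h⟩
    exact Or.inr ⟨b, hb, h.symm⟩

lemma card_greenSet_succ (p : ℕ → Fin k → Fin n) (t : ℕ) :
    #(greenSet n k p (t + 1)) =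
      ∑ v ∈ (greenSet n k p t).image (p (t + 1)), load (p (t + 1)) v := by
  rw [card_eq_sum_card_fiberwise (f := p (t + 1)) (t := (greenSet n k p t).image (p (t + 1)))
    fun a ha => mem_greenSet_succ.1 ha]
  refine sum_congr rfl fun v hv => ?_
  unfold load
  congr 1
  ext a
  simp only [mem_filter, mem_univ, true_and, and_iff_right_iff_imp]
  rintro rfl
  exact mem_greenSet_succ.2 hv

lemma LoadGood.card_greenSet_succ_ge {p : ℕ → Fin k → Fin n} {t : ℕ}
    (h : LoadGood c (p (t + 1))) :
    #((greenSet n k p t).image (p (t + 1))) * (c / 8) ≤ #(greenSet n k p (t + 1)) := by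
  rw [card_greenSet_succ, Nat.cast_sum, ← nsmul_eq_mul]
  exact card_nsmul_le_sum _ _ _ fun v _ => (h v).1

lemma LoadGood.card_greenSet_succ_le {p : ℕ → Fin k → Fin n} {t : ℕ} (hc : 0 ≤ c)
    (h : LoadGood c (p (t + 1))) :
    (#(greenSet n k p (t + 1)) : ℝ) ≤ #(greenSet n k p t) * (4 * c) := by
  calc _ ≤ #((greenSet n k p t).image (p (t + 1))) * (4 * c) := by
        rw [card_greenSet_succ, Nat.cast_sum, ← nsmul_eq_mul]
        exact sum_le_card_nsmul _ _ _ fun v _ => (h v).2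
    _ ≤ _ := by gcongr; exact card_image_le

lemma GoodTraj.card_greenSet_le (hk : 0 < k) (hc : 0 ≤ c) {T : ℕ} {p : ℕ → Fin k → Fin n}
    (h : GoodTraj c T p) : (#(greenSet n k p T) : ℝ) ≤ (4 * c) ^ (T + 1) := by
  induction T with
  | zero =>
    rw [card_greenSet_zero hk]
    simpa using (h.1 _).2
  | succ T ih =>
    refine ((h.loadGood le_rfl).card_greenSet_succ_le hc).trans ?_
    rw [pow_succ _ (T + 1)]
    gcongr
    exact ih (h.mono (Nat.le_succ T))

lemma GoodTraj.le_card_greenSet (hk0 : 0 < k) (hk : (k:ℝ) = c * n) (hc : 128 ≤ c) {T : ℕ}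
    {p : ℕ → Fin k → Fin n} (h : GoodTraj c T p) :
    min ((c / 128) ^ (T + 1)) ((k:ℝ) / 128) ≤ #(greenSet n k p T) := by
  induction T with
  | zero =>
    rw [card_greenSet_zero hk0]
    refine (min_le_left _ _).trans (le_trans ?_ (h.1 _).1)
    rw [zero_add, pow_one]
    linarith
  | succ T ih =>
    have ih := ih (h.mono (Nat.le_succ T))
    have h1 := (h.loadGood le_rfl).card_greenSet_succ_ge
    have h2 := (h.2 T (Nat.lt_succ_self T)).2.1
    have h2' : min (#(greenSet n k p T) : ℝ) n ≤
        16 * #((greenSet n k p T).image (p (T + 1))) := by exact_mod_cast h2.le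
    have h3 : min (#(greenSet n k p T) : ℝ) n * (c / 128) ≤ #(greenSet n k p (T + 1)) := by
      refine le_trans ?_ h1
      nlinarith
    refine le_trans ?_ h3
    have hb : 1 ≤ c / 128 := by linarith
    have hkn : (k:ℝ) / 128 = n * (c / 128) := by rw [hk]; ring
    rcases le_total (#(greenSet n k p T) : ℝ) n with hle | hle
    · rw [min_eq_left hle]
      calc _ ≤ min ((c / 128) ^ (T + 1)) ((k:ℝ) / 128) * (c / 128) := by
            rw [min_mul_of_nonneg _ _ (by linarith), ← pow_succ]
            refine min_le_min le_rfl (le_mul_of_one_le_right (by positivity) hb)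
        _ ≤ _ := by gcongr
    · rw [min_eq_right hle, ← hkn]
      exact min_le_right _ _

lemma GoodTraj.le_card_greenSet' (hk0 : 0 < k) {T : ℕ}
    {p : ℕ → Fin k → Fin n} (h : GoodTraj c T p) : c / 8 ≤ #(greenSet n k p T) := by
  have hmono : ∀ t, #(greenSet n k p 0) ≤ #(greenSet n k p t) := by
    intro t
    induction t with
    | zero => exact le_rfl
    | succ t ih => exact ih.trans (card_le_card subset_union_left)
  refine le_trans ?_ (Nat.cast_le.2 (hmono T))
  rw [card_greenSet_zero hk0]
  exact (h.1 _).1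

lemma GoodTraj.greenSet_eq_univ (hk0 : 0 < k) (hk : (k:ℝ) = c * n) (hc : 128 ≤ c) {T : ℕ}
    {p : ℕ → Fin k → Fin n} (h : GoodTraj c (T + 1) p) (hT : (n:ℝ) ≤ (c / 128) ^ T) :
    greenSet n k p (T + 1) = univ := by
  have h1 := (h.mono (Nat.le_succ T)).le_card_greenSet hk0 hk hc
  have h2 : (k:ℝ) / 128 ≤ (c / 128) ^ (T + 1) := by
    rw [pow_succ, hk, mul_comm c, mul_div_assoc]
    gcongr
  rw [min_eq_right h2] at h1
  refine eq_univ_of_forall fun a => mem_greenSet_succ.2 ?_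
  obtain ⟨b, hb, hba⟩ := (h.2 T (Nat.lt_succ_self T)).2.2 h1 (p (T + 1) a)
  exact mem_image.2 ⟨b, hb, hba⟩

lemma one_sub_le_trajProb_goodTraj (hk0 : 0 < k) (hk : (k:ℝ) = c * n) (hn : 1024 ≤ n)
    (hc : 0 < c) (hcn : c ≤ 8 * n) (T : ℕ) :
    1 - (T + 1) * (4 * n * Real.exp (-(c / 256))) ≤ trajProb n k T (GoodTraj c T) := by
  have hn' : (1024:ℝ) ≤ n := by exact_mod_cast hn
  induction T with
  | zero =>
    have hq1 : ∀ a : Fin k, ∑ _v : Fin n, (n:ℝ)⁻¹ = 1 := fun a => by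
      have : (n:ℝ) ≠ 0 := by linarith
      simp [this]
    have h1 : trajProb n k 0 (GoodTraj c 0) =
        prodProb (fun _ _ => (n:ℝ)⁻¹) (LoadGood c : (Fin k → Fin n) → Prop) := by
      rw [trajProb_zero]
      simp [GoodTraj]
    have h2 := prodProb_add_not hq1 (LoadGood c : (Fin k → Fin n) → Prop)
    have h3 := prodProb_not_loadGood_le (k := k) (n := n) (c := c) (q := fun _ _ => (n:ℝ)⁻¹)
      (fun _ _ => by positivity) hq1 (fun _ _ => inv_anti₀ (by linarith) (by linarith))
      (fun v => by simp [hc.le]) hk hn hc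
    have h4 : 0 ≤ n * Real.exp (-(c / 256)) := by positivity
    rw [h1]
    push_cast
    linarith
  | succ T ih =>
    have h := trajProb_le_succ_add (n := n) (k := k) (by omega) (T := T) (A := GoodTraj c T)
      (B := GoodTraj c (T + 1)) (R := fun p x => RoundGood c (greenSet n k p T) x)
      (ε := 4 * n * Real.exp (-(c / 256))) (by positivity) (goodTraj_dependsUpTo T)
      (fun x p p' hp h => by
        simp only [← greenSet_congr hp]
        exact h)
      (fun p hA hR => ⟨hA.1, fun t ht => by
        rcases Nat.lt_succ_iff_lt_or_eq.1 ht with h | rfl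
        exacts [hA.2 t h, hR]⟩)
      (fun p hA => prodProb_not_roundGood_le (moveProb_nonneg (by omega) _)
        (sum_moveProb (by omega) _) (moveProb_le (by omega) _)
        (fun v => (Nat.cast_le.2 (card_moveProb_lt_le (by omega) _ v)).trans
          (hA.loadGood le_rfl v).2) hk hn hc hcn (hA.le_card_greenSet' hk0))
    push_cast
    linarith

lemma probXiLe_le_of_lt (hk0 : 0 < k) (hk : (k:ℝ) = c * n) (hn : 1024 ≤ n)
    (hc : 0 < c) (hcn : c ≤ 8 * n) {T : ℕ} (hT : (4 * c) ^ (T + 1) < k) :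
    probXiLe n k T ≤ (T + 1) * (4 * n * Real.exp (-(c / 256))) := by
  have h1 := one_sub_le_trajProb_goodTraj hk0 hk hn hc hcn T
  have h2 := trajProb_add_not (n := n) (k := k) T (GoodTraj c T)
  rw [trajProb_true (by omega)] at h2
  have h3 : probXiLe n k T ≤ trajProb n k T (fun p => ¬ GoodTraj c T p) := by
    rw [probXiLe_eq_trajProb]
    refine trajProb_mono (by omega) fun p hp hg => ?_
    have := hg.card_greenSet_le hk0 hc.le
    rw [hp, card_univ, Fintype.card_fin] at this
    linarith
  linarith

lemma le_probXiLe_of_le (hk0 : 0 < k) (hk : (k:ℝ) = c * n) (hn : 1024 ≤ n)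
    (hc : 128 ≤ c) (hcn : c ≤ 8 * n) {T : ℕ} (hT : (n:ℝ) ≤ (c / 128) ^ T) :
    1 - ((T + 1 : ℕ) + 1) * (4 * n * Real.exp (-(c / 256))) ≤ probXiLe n k (T + 1) := by
  refine (one_sub_le_trajProb_goodTraj hk0 hk hn (by linarith) hcn (T + 1)).trans ?_
  rw [probXiLe_eq_trajProb]
  exact trajProb_mono (by omega) fun p hp => hp.greenSet_eq_univ hk0 hk hc hT

end GoodTrajectory

set_option maxHeartbeats 1000000 in
lemma probXiMem_superdense_bounds {n k : ℕ} {c : ℝ} (hk : (k:ℝ) = c * n)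
    (hu : 1024 ≤ Real.log n) (hL : 16 ≤ Real.log (Real.log n)) (hc : Real.log n ^ 2 ≤ c)
    (hcn : c ≤ n) :
    1 - 8 / n ≤ probXiMem n k {t |
          |(t : ℝ) - Real.log n / Real.log c|
            ≤ 10 * ((Real.log n / Real.log c) /
                Real.sqrt (Real.log (Real.log (Real.log n))) + 1)} ∧
    probXiMem n k {t |
          |(t : ℝ) - Real.log n / Real.log c|
            ≤ 10 * ((Real.log n / Real.log c) /
                Real.sqrt (Real.log (Real.log (Real.log n))) + 1)} ≤ 1 := by
  have hl1 := Real.log_two_gt_d9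
  have hl2 := Real.log_two_lt_d9
  have hn0 : (0:ℝ) < n := by
    rcases Nat.eq_zero_or_pos n with rfl | h
    · norm_num at hu
    · exact_mod_cast h
  set u := Real.log n with hudef
  set L := Real.log u with hLdef
  have hn1024 : (1024:ℝ) ≤ n := by linarith [Real.log_le_sub_one_of_pos hn0]
  have hn : 1024 ≤ n := by exact_mod_cast hn1024
  have hc1024 : (1024:ℝ) ≤ c := by nlinarith
  have hk0 : 0 < k := by
    have : (0:ℝ) < k := by rw [hk]; positivity
    exact_mod_cast this
  have hnk : (n:ℝ) ≤ k := by rw [hk]; nlinarith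
  have hℓ : 2 * L ≤ Real.log c := by
    have := Real.log_le_log (by positivity) hc
    rwa [Real.log_pow, Nat.cast_ofNat] at this
  set ℓ := Real.log c with hℓdef
  have hlogb : Real.log (c / 128) = ℓ - 7 * Real.log 2 := by
    rw [Real.log_div (by linarith) (by norm_num), show (128:ℝ) = 2 ^ 7 by norm_num, Real.log_pow,
      hℓdef]
    push_cast
    ring
  have hlog4 : Real.log (4 * c) = ℓ + 2 * Real.log 2 := by
    rw [Real.log_mul (by norm_num) (by linarith), show (4:ℝ) = 2 ^ 2 by norm_num, Real.log_pow]
    push_cast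
    ring
  set lb := Real.log (c / 128) with hlb
  set l4 := Real.log (4 * c) with hl4
  have hlbL : L ≤ lb := by linarith
  have hu0 : 0 < u := by linarith
  have hy0 : 0 ≤ u / ℓ := div_nonneg hu0.le (by linarith)
  set s := Real.sqrt (Real.log L) with hs
  have hlogL : 0 < Real.log L := Real.log_pos (by linarith)
  have hs0 : 0 < s := Real.sqrt_pos.2 hlogL
  have hsL : s ≤ L := by
    rw [hs, Real.sqrt_le_left (by linarith)]
    nlinarith [Real.log_le_sub_one_of_pos (show 0 < L by linarith)]
  have hsinv : u / ℓ / L ≤ u / ℓ / s := by gcongr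
  have hub : u / lb - u / ℓ ≤ 5 * (u / ℓ / s) := by
    have h1 : u / lb - u / ℓ = u / ℓ * ((7 * Real.log 2) / lb) := by
      rw [hlogb]
      have : ℓ ≠ 0 := by linarith
      have : ℓ - 7 * Real.log 2 ≠ 0 := by linarith
      field_simp
      ring
    have h2 : (7 * Real.log 2) / lb ≤ 5 / L := by gcongr; linarith
    calc _ ≤ u / ℓ * (5 / L) := by rw [h1]; gcongr
      _ = 5 * (u / ℓ / L) := by ring
      _ ≤ _ := by gcongr
  have hlb4 : u / ℓ - u / l4 ≤ 5 * (u / ℓ / s) := by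
    have h1 : u / ℓ - u / l4 = u / ℓ * ((2 * Real.log 2) / l4) := by
      rw [hlog4]
      have : ℓ ≠ 0 := by linarith
      have : ℓ + 2 * Real.log 2 ≠ 0 := by linarith
      field_simp
      ring
    have h2 : (2 * Real.log 2) / l4 ≤ 5 / L := by gcongr <;> linarith
    calc _ ≤ u / ℓ * (5 / L) := by rw [h1]; gcongr
      _ = 5 * (u / ℓ / L) := by ring
      _ ≤ _ := by gcongr
  have hz0 : 0 ≤ u / ℓ / s := by positivity
  set ε := 4 * n * Real.exp (-(c / 256)) with hε
  have hε0 : 0 ≤ ε := by positivity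
  set T := ⌈u / lb⌉₊ with hT
  have hT1 : u / lb ≤ T := Nat.le_ceil _
  have hT2 : (T:ℝ) < u / lb + 1 := Nat.ceil_lt_add_one (div_nonneg hu0.le (by linarith))
  have hnT : (n:ℝ) ≤ (c / 128) ^ T := by
    rw [← Real.log_le_log_iff hn0 (by positivity), Real.log_pow]
    rwa [div_le_iff₀ (by linarith)] at hT1
  have hub1 : u / lb ≤ u := div_le_self hu0.le (by linarith)
  have hδ : ((T + 1 : ℕ) + 1) * ε ≤ 4 / n := by
    have hexp : Real.exp u = n := Real.exp_log hn0
    have h1 : (((T + 1 : ℕ) : ℝ) + 1) ≤ n := by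
      rw [← hexp]
      push_cast
      nlinarith [Real.quadratic_le_exp_of_nonneg hu0.le]
    calc _ ≤ n * ε := by gcongr
      _ = 4 * Real.exp (u + u - c / 256) := by
          rw [hε, sub_eq_add_neg, Real.exp_add, Real.exp_add, hexp]; ring
      _ ≤ 4 * Real.exp (-u) := by
          gcongr
          nlinarith
      _ = _ := by rw [Real.exp_neg, hexp]; rfl
  have key := probXiMem_bounds (n := n) (k := k) (by omega)
    (S := {t | |(t : ℝ) - u / ℓ| ≤ 10 * (u / ℓ / s + 1)})
    (A := ⌈u / l4 - 1⌉₊) (B := T + 1) (N := ⌊u / ℓ + 10 * (u / ℓ / s + 1)⌋₊)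
    (δ := ((T + 1 : ℕ) + 1) * ε) (by positivity)
    (fun t ht => Nat.le_floor (by
      have := (abs_le.1 (Set.mem_ofPred_eq ▸ ht)).2
      linarith))
    (fun t h1 h2 => by
      rw [Set.mem_ofPred_eq, abs_le]
      have h1 : u / l4 - 1 ≤ t := Nat.ceil_le.1 h1
      have h2 : (t:ℝ) ≤ T + 1 := by exact_mod_cast h2
      constructor <;> linarith)
    (fun t ht => by
      have h1 : (t:ℝ) < u / l4 - 1 := Nat.lt_ceil.1 ht
      have h4 : 0 < l4 := by linarith
      have h2 : (4 * c) ^ (t + 1) < k := by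
        refine lt_of_lt_of_le ?_ hnk
        rw [← Real.log_lt_log_iff (by positivity) hn0, Real.log_pow]
        push_cast
        rw [← lt_div_iff₀ h4]
        linarith
      refine (probXiLe_le_of_lt hk0 hk hn (by linarith) (by linarith) h2).trans ?_
      have h3 : u / l4 ≤ u / lb := by gcongr <;> linarith
      have : (t:ℝ) + 1 ≤ (T + 1 : ℕ) + 1 := by push_cast; linarith
      gcongr)
    (le_probXiLe_of_le hk0 hk hn (by linarith) (by linarith) hnT)
  refine ⟨le_trans ?_ key.1, key.2⟩
  have : (8:ℝ) / n = 2 * (4 / n) := by ring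
  linarith

/-- **Theorem 4.6.**  Suppose `k = k(n) = c(n)·n` where `(ln n)² ≤ c(n)` and `c = n^{o(1)}`
(that is, `ln c / ln n → 0`).  Then there is a constant `C > 0` such that a.a.s.
`|ξ(K_n, k) − ln n/ln c| ≤ C·((ln n/ln c)/√(ln ln ln n) + 1)`. -/
theorem broadcasting_time_superdense_k
    (c : ℕ → ℝ) (k : ℕ → ℕ)
    (hkc : ∀ n, (k n : ℝ) = c n * n)
    (hc : ∀ᶠ n : ℕ in atTop, (Real.log n) ^ 2 ≤ c n)
    (hco : Tendsto (fun n => Real.log (c n) / Real.log n) atTop (nhds 0)) :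
    ∃ C > (0:ℝ), Tendsto (fun n =>
        probXiMem n (k n) {t |
          |(t : ℝ) - Real.log n / Real.log (c n)|
            ≤ C * ((Real.log n / Real.log (c n)) /
                Real.sqrt (Real.log (Real.log (Real.log n))) + 1)})
      atTop (nhds 1) := by
  have hlog : Tendsto (fun n : ℕ => Real.log n) atTop atTop :=
    Real.tendsto_log_atTop.comp tendsto_natCast_atTop_atTop
  have hev : ∀ᶠ n : ℕ in atTop, 1024 ≤ Real.log n ∧ 16 ≤ Real.log (Real.log n) ∧
      Real.log n ^ 2 ≤ c n ∧ c n ≤ n := by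
    filter_upwards [hlog.eventually_ge_atTop 1024,
      (Real.tendsto_log_atTop.comp hlog).eventually_ge_atTop 16, hc,
      hco.eventually_lt_const one_pos, eventually_gt_atTop 0] with n h1 h2 h3 h4 h5
    refine ⟨h1, h2, h3, ?_⟩
    rw [div_lt_one (by linarith)] at h4
    exact ((Real.log_lt_log_iff (by nlinarith) (by exact_mod_cast h5)).1 h4).le
  have hlim : Tendsto (fun n : ℕ => 1 - (8:ℝ) / n) atTop (nhds 1) := by
    simpa using (tendsto_const_div_atTop_nhds_zero_nat (8:ℝ)).const_sub 1
  refine ⟨10, by norm_num, tendsto_of_tendsto_of_tendsto_of_le_of_le' hlim tendsto_const_nhds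
    ?_ ?_⟩
  · filter_upwards [hev] with n ⟨h1, h2, h3, h4⟩
    exact (probXiMem_superdense_bounds (hkc n) h1 h2 h3 h4).1
  · filter_upwards [hev] with n ⟨h1, h2, h3, h4⟩
    exact (probXiMem_superdense_bounds (hkc n) h1 h2 h3 h4).2
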